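/- Define g₁(ξ,θ;s) = −(sinh(ξ−s)/(2a_ε))·(w_θ(ξ)/w_θ(ξ−s))³. There exist C > 0 and ε₀ > 0 such that for all ε ∈ (0, ε₀), every constant c satisfying |ξ| ≤ c − ξ ≤ 3(ξ₁+ξ₂) for all ξ ∈ [−ξ₁, ξ₂], and all ξ ∈ [−ξ₁, ξ₂], θ ∈ [0,π]: |∑_{m=0}^∞ g₁(ξ,θ;2s₀·m + c) − (1/(2s₀))·∫₀^∞ g₁(ξ,θ;t + c) dt| ≤ C, where C is independent of ξ, θ, ε and c. -/

import Mathlib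

open Real MeasureTheory

noncomputable section

/-- The distance parameter `a_ε`. -/
def aEps (r₁ r₂ ε : ℝ) : ℝ :=
  Real.sqrt ε * Real.sqrt ((2*r₁+ε)*(2*r₂+ε)*(2*r₁+2*r₂+ε)) / (2*(r₁+r₂+ε))

def xi (r : ℝ) (r₁ r₂ ε : ℝ) : ℝ := Real.arsinh (aEps r₁ r₂ ε / r)

def sZero (r₁ r₂ ε : ℝ) : ℝ := xi r₁ r₁ r₂ ε + xi r₂ r₁ r₂ ε

/-- `w θ ξ = √(cosh ξ − cos θ)`. -/
def w (θ ξ : ℝ) : ℝ := Real.sqrt (Real.cosh ξ - Real.cos θ)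

/-- `g₁(ξ,θ;s) = −(sinh(ξ−s)/(2a_ε))·(w_θ(ξ)/w_θ(ξ−s))³`. -/
def g1 (r₁ r₂ ε ξ θ s : ℝ) : ℝ :=
  -(Real.sinh (ξ - s) / (2 * aEps r₁ r₂ ε)) * (w θ ξ / w θ (ξ - s)) ^ 3

theorem abs_sub_le_sub_of_abs_deriv_le {p p' H H' : ℝ → ℝ} {a b : ℝ}
    (hp : ∀ x ∈ Set.Icc a b, HasDerivAt p (p' x) x)
    (hH : ∀ x ∈ Set.Icc a b, HasDerivAt H (H' x) x)
    (hle : ∀ x ∈ Set.Icc a b, |p' x| ≤ H' x) (hab : a ≤ b) :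
    |p b - p a| ≤ H b - H a := by
  have key : ∀ q q' : ℝ → ℝ, (∀ x ∈ Set.Icc a b, HasDerivAt q (q' x) x) →
      (∀ x ∈ Set.Icc a b, 0 ≤ q' x) → q a ≤ q b := by
    intro q q' hq hq'
    refine monotoneOn_of_hasDerivWithinAt_nonneg (f' := q') (convex_Icc a b)
      (fun x hx => (hq x hx).continuousAt.continuousWithinAt)
      (fun x hx => (hq x (interior_subset hx)).hasDerivWithinAt)
      (fun x hx => hq' x (interior_subset hx)) (Set.left_mem_Icc.2 hab) (Set.right_mem_Icc.2 hab) hab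
  have h1 := key (fun x => H x - p x) (fun x => H' x - p' x)
    (fun x hx => (hH x hx).sub (hp x hx)) (fun x hx => by linarith [(abs_le.1 (hle x hx)).2])
  have h2 := key (fun x => H x + p x) (fun x => H' x + p' x)
    (fun x hx => (hH x hx).add (hp x hx)) (fun x hx => by linarith [(abs_le.1 (hle x hx)).1])
  exact abs_le.2 ⟨by linarith, by linarith⟩

theorem abs_trapezoid_sub_le {F f f' f'' H H' : ℝ → ℝ} {a b : ℝ}
    (hF : ∀ x ∈ Set.Icc a b, HasDerivAt F (f x) x)
    (hf : ∀ x ∈ Set.Icc a b, HasDerivAt f (f' x) x)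
    (hf' : ∀ x ∈ Set.Icc a b, HasDerivAt f' (f'' x) x)
    (hH : ∀ x ∈ Set.Icc a b, HasDerivAt H (H' x) x)
    (hle : ∀ x ∈ Set.Icc a b, |f'' x| ≤ H' x) (hab : a ≤ b) :
    |(b - a) / 2 * (f a + f b) - (F b - F a)| ≤ (b - a) ^ 2 / 2 * (H b - H a) := by
  have hslope : ∀ x ∈ Set.Icc a b,
      |(f a - f x) / 2 + (x - a) / 2 * f' x| ≤ (b - a) / 2 * (H b - H a) := by
    intro x hx
    have hsub : ∀ y ∈ Set.Icc a x, y ∈ Set.Icc a b := fun y hy => ⟨hy.1, hy.2.trans hx.2⟩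
    have h1 := abs_sub_le_sub_of_abs_deriv_le (a := a) (b := x)
      (p := fun y => (f a - f y) / 2 + (y - a) / 2 * f' y)
      (p' := fun y => (y - a) / 2 * f'' y)
      (H := fun y => (b - a) / 2 * H y) (H' := fun y => (b - a) / 2 * H' y)
      (fun y hy => by
        have := (((hf y (hsub y hy)).const_sub (f a)).div_const 2).add
          ((((hasDerivAt_id y).sub_const a).div_const 2).mul (hf' y (hsub y hy)))
        refine this.congr_deriv ?_
        simp only [id]
        ring)
      (fun y hy => (hH y (hsub y hy)).const_mul _)
      (fun y hy => by
        have h0 := hle y (hsub y hy)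
        have hya : 0 ≤ y - a := sub_nonneg.2 hy.1
        rw [abs_mul, abs_of_nonneg (by linarith : (0:ℝ) ≤ (y - a) / 2)]
        exact mul_le_mul (by linarith [(hsub y hy).2]) h0 (abs_nonneg _) (by linarith))
      hx.1
    have hmono : |(0:ℝ) - 0| ≤ H b - H x :=
      abs_sub_le_sub_of_abs_deriv_le (p := fun _ => (0:ℝ)) (p' := fun _ => 0)
        (fun y _ => hasDerivAt_const y 0)
        (fun y hy => hH y ⟨hx.1.trans hy.1, hy.2⟩)
        (fun y hy => by
          rw [abs_zero]
          exact (abs_nonneg _).trans (hle y ⟨hx.1.trans hy.1, hy.2⟩)) hx.2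
    simp only [sub_self, zero_div, zero_mul, add_zero, sub_zero, abs_zero] at h1 hmono
    have hba : 0 ≤ (b - a) / 2 := by linarith
    nlinarith [mul_nonneg hba hmono]
  have h2 := abs_sub_le_sub_of_abs_deriv_le (a := a) (b := b)
    (p := fun x => (x - a) / 2 * (f a + f x) - F x)
    (p' := fun x => (f a - f x) / 2 + (x - a) / 2 * f' x)
    (H := fun x => (b - a) / 2 * (H b - H a) * x) (H' := fun _ => (b - a) / 2 * (H b - H a))
    (fun y hy => by
      have := ((((hasDerivAt_id y).sub_const a).div_const 2).mul ((hf y hy).const_add (f a))).sub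
        (hF y hy)
      refine this.congr_deriv ?_
      simp only [id]
      ring)
    (fun y _ => by simpa using (hasDerivAt_id y).const_mul ((b - a) / 2 * (H b - H a)))
    hslope hab
  simp only [sub_self, zero_div, zero_mul, zero_sub] at h2
  calc _ = |(b - a) / 2 * (f a + f b) - F b - -F a| := by congr 1; ring
    _ ≤ _ := h2
    _ = _ := by ring

theorem abs_tsum_sub_integral_le {F f f' f'' H H' : ℝ → ℝ} {u h : ℝ} (hh : 0 < h)
    (hF : ∀ x ∈ Set.Ici u, HasDerivAt F (f x) x)
    (hf : ∀ x ∈ Set.Ici u, HasDerivAt f (f' x) x)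
    (hf' : ∀ x ∈ Set.Ici u, HasDerivAt f' (f'' x) x)
    (hH : ∀ x ∈ Set.Ici u, HasDerivAt H (H' x) x)
    (hle : ∀ x ∈ Set.Ici u, |f'' x| ≤ H' x)
    (hpos : ∀ x ∈ Set.Ici u, 0 ≤ f x)
    (hFnonpos : ∀ x, F x ≤ 0) (hHnonpos : ∀ x, H x ≤ 0)
    (hFlim : Filter.Tendsto F Filter.atTop (nhds 0)) :
    |(∑' m : ℕ, f (u + h * m)) - 1 / h * ∫ t in Set.Ioi (0:ℝ), f (u + t)|
      ≤ f u / 2 + h / 2 * (-H u) := by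
  have hmem : ∀ m : ℕ, u ≤ u + h * m := fun m => by
    have : 0 ≤ h * (m:ℝ) := by positivity
    linarith
  have hpart : ∀ N : ℕ,
      |h * (∑ m ∈ Finset.range N, f (u + h * m)) - h / 2 * (f u - f (u + h * N))
        - (F (u + h * N) - F u)| ≤ h ^ 2 / 2 * (H (u + h * N) - H u) := by
    intro N
    induction N with
    | zero => simp
    | succ n ih =>
      have hsub : ∀ x ∈ Set.Icc (u + h * n) (u + h * (n + 1 : ℕ)), x ∈ Set.Ici u :=
        fun x hx => (hmem n).trans hx.1
      have hstep := abs_trapezoid_sub_le (fun x hx => hF x (hsub x hx))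
        (fun x hx => hf x (hsub x hx)) (fun x hx => hf' x (hsub x hx))
        (fun x hx => hH x (hsub x hx)) (fun x hx => hle x (hsub x hx))
        (by push_cast; linarith)
      have hdiff : u + h * (n + 1 : ℕ) - (u + h * n) = h := by push_cast; ring
      rw [hdiff] at hstep
      rw [Finset.sum_range_succ]
      rw [abs_le] at ih hstep ⊢
      constructor <;> linarith [ih.1, ih.2, hstep.1, hstep.2]
  have hsum : Summable fun m : ℕ => f (u + h * m) := by
    refine summable_of_sum_range_le (c := (h / 2 * f u - F u + h ^ 2 / 2 * (-H u)) / h)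
      (fun m => hpos _ (hmem m)) fun N => ?_
    rw [le_div_iff₀ hh]
    have h1 := (abs_le.1 (hpart N)).2
    have h2 := mul_nonneg hh.le (hpos _ (hmem N))
    have h3 := hFnonpos (u + h * N)
    have h4 := mul_nonneg (by positivity : 0 ≤ h ^ 2 / 2) (neg_nonneg.2 (hHnonpos (u + h * N)))
    linarith
  have harg : Filter.Tendsto (fun t : ℝ => u + t) Filter.atTop Filter.atTop :=
    Filter.tendsto_atTop_add_const_left _ _ Filter.tendsto_id
  have hint : ∫ t in Set.Ioi (0:ℝ), f (u + t) = -F u := by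
    have hderiv : ∀ x ∈ Set.Ici (0:ℝ), HasDerivAt (fun t => F (u + t)) (f (u + x)) x := by
      intro x hx
      have hx' : u + x ∈ Set.Ici u := Set.mem_Ici.2 (le_add_of_nonneg_right hx)
      simpa using (hF _ hx').comp_const_add u x
    have := integral_Ioi_of_hasDerivAt_of_nonneg' hderiv
      (fun x hx => hpos _ (Set.mem_Ici.2 (le_add_of_nonneg_right (le_of_lt hx)))) (hFlim.comp harg)
    rw [this, add_zero, zero_sub]
  rw [hint]
  have hnat : Filter.Tendsto (fun N : ℕ => h * (N:ℝ)) Filter.atTop Filter.atTop :=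
    tendsto_natCast_atTop_atTop.const_mul_atTop hh
  have hlim := (((hsum.hasSum.tendsto_sum_nat.const_mul h).sub
    ((hsum.tendsto_atTop_zero.const_sub (f u)).const_mul (h / 2))).sub
    ((hFlim.comp (harg.comp hnat)).sub_const (F u))).abs
  have hlast := le_of_tendsto hlim (b := h ^ 2 / 2 * (-H u)) (.of_forall fun N => by
    refine (hpart N).trans (mul_le_mul_of_nonneg_left ?_ (by positivity))
    linarith [hHnonpos (u + h * N)])
  have hu := hpos u Set.self_mem_Ici
  rw [abs_le] at hlast
  have hmul : ∀ S : ℝ, S - 1 / h * -F u = (h * S + F u) / h := fun S => by field_simp; ring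
  rw [hmul, abs_div, abs_of_pos hh, div_le_iff₀ hh, abs_le]
  have := mul_nonneg hh.le hu
  constructor <;> linarith [hlast.1, hlast.2]

theorem w_sq {θ ξ : ℝ} : w θ ξ ^ 2 = Real.cosh ξ - Real.cos θ :=
  Real.sq_sqrt (by linarith [Real.one_le_cosh ξ, Real.cos_le_one θ])

theorem w_nonneg (θ ξ : ℝ) : 0 ≤ w θ ξ := Real.sqrt_nonneg _

theorem w_le_w {θ x y : ℝ} (h : |x| ≤ |y|) : w θ x ≤ w θ y :=
  Real.sqrt_le_sqrt (by linarith [Real.cosh_le_cosh.2 h])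

theorem hasDerivAt_w {θ x : ℝ} (hx : 0 < w θ x) :
    HasDerivAt (w θ) (Real.sinh x / (2 * w θ x)) x :=
  ((Real.hasDerivAt_cosh x).sub_const (Real.cos θ)).sqrt (Real.sqrt_pos.1 hx).ne'

theorem tendsto_w_atTop (θ : ℝ) : Filter.Tendsto (w θ) Filter.atTop Filter.atTop := by
  refine Real.tendsto_sqrt_atTop.comp ?_
  refine Filter.tendsto_atTop_mono (f := fun x => Real.sinh x - 1) (fun x => ?_)
    (Filter.tendsto_atTop_add_const_right _ _ Real.sinhOrderIso.tendsto_atTop)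
  linarith [Real.sinh_lt_cosh x, Real.cos_le_one θ]

theorem sinh_le_self_mul_cosh {x y : ℝ} (hx : 0 ≤ x) (hxy : x ≤ y) :
    Real.sinh x ≤ x * Real.cosh y := by
  have h := abs_sub_le_sub_of_abs_deriv_le (a := 0) (b := x) (p := Real.sinh) (p' := Real.cosh)
    (H := fun t => t * Real.cosh y) (H' := fun _ => Real.cosh y)
    (fun t _ => Real.hasDerivAt_sinh t)
    (fun t _ => by simpa using (hasDerivAt_id t).mul_const (Real.cosh y))
    (fun t ht => by
      rw [abs_of_pos (Real.cosh_pos t), Real.cosh_le_cosh, abs_of_nonneg ht.1,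
        abs_of_nonneg (hx.trans hxy)]
      exact ht.2.trans hxy) hx
  simpa using (le_abs_self _).trans h

theorem abs_tsum_sinh_div_w_sub_integral_le {θ u h : ℝ} (hh : 0 < h) (hu : 0 ≤ u)
    (hw : 0 < w θ u) :
    |(∑' m : ℕ, Real.sinh (u + h * m) / w θ (u + h * m) ^ 3)
        - 1 / h * ∫ t in Set.Ioi (0:ℝ), Real.sinh (u + t) / w θ (u + t) ^ 3|
      ≤ Real.sinh u / w θ u ^ 3 / 2 + h / 2 * (10 * (2 / w θ u + 4 / 3 / w θ u ^ 3)) := by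
  have hpos : ∀ x ∈ Set.Ici u, 0 < w θ x := fun x hx =>
    hw.trans_le (w_le_w (by rw [abs_of_nonneg hu, abs_of_nonneg (hu.trans hx)]; exact hx))
  have hk : 0 ≤ 1 + Real.cos θ := by linarith [Real.neg_one_le_cos θ]
  have main := abs_tsum_sub_integral_le (u := u) hh
    (F := fun x => -2 / w θ x)
    (f := fun x => Real.sinh x / w θ x ^ 3)
    (f' := fun x => Real.cosh x / w θ x ^ 3 - 3 / 2 * (Real.sinh x ^ 2 / w θ x ^ 5))
    (f'' := fun x => Real.sinh x / w θ x ^ 3 - 9 / 2 * (Real.sinh x * Real.cosh x / w θ x ^ 5)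
      + 15 / 4 * (Real.sinh x ^ 3 / w θ x ^ 7))
    (H := fun x => 10 * (-2 / w θ x + -(2 / 3 * (1 + Real.cos θ)) / w θ x ^ 3))
    (H' := fun x => 10 * (Real.sinh x * (Real.cosh x + 1) / w θ x ^ 5))
    (fun x hx => by
      have hx0 := hpos x hx
      refine HasDerivAt.congr_deriv ((hasDerivAt_const x (-2:ℝ)).div (hasDerivAt_w hx0) hx0.ne') ?_
      field_simp
      ring)
    (fun x hx => by
      have hx0 := hpos x hx
      refine HasDerivAt.congr_deriv
        ((Real.hasDerivAt_sinh x).div ((hasDerivAt_w hx0).pow 3) (pow_ne_zero 3 hx0.ne')) ?_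
      field_simp
      ring)
    (fun x hx => by
      have hx0 := hpos x hx
      refine HasDerivAt.congr_deriv
        (((Real.hasDerivAt_cosh x).div ((hasDerivAt_w hx0).pow 3) (pow_ne_zero 3 hx0.ne')).sub
        ((((Real.hasDerivAt_sinh x).pow 2).div ((hasDerivAt_w hx0).pow 5)
          (pow_ne_zero 5 hx0.ne')).const_mul (3 / 2))) ?_
      simp only [Pi.pow_apply]
      field_simp
      ring)
    (fun x hx => by
      have hx0 := hpos x hx
      refine HasDerivAt.congr_deriv
        (((((hasDerivAt_const x (-2:ℝ)).div (hasDerivAt_w hx0) hx0.ne').add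
        ((hasDerivAt_const x (-(2 / 3 * (1 + Real.cos θ)))).div ((hasDerivAt_w hx0).pow 3)
          (pow_ne_zero 3 hx0.ne'))).const_mul 10)) ?_
      have hc : Real.cosh x = w θ x ^ 2 + Real.cos θ := by rw [w_sq]; ring
      rw [hc]
      simp only [Pi.pow_apply]
      field_simp
      ring)
    (fun x hx => by
      have hx0 := hpos x hx
      have hS : 0 ≤ Real.sinh x := Real.sinh_nonneg_iff.2 (hu.trans hx)
      have hC := Real.one_le_cosh x
      have hW : w θ x ^ 2 ≤ Real.cosh x + 1 := by rw [w_sq]; linarith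
      have hS2 : Real.sinh x ^ 2 ≤ w θ x ^ 2 * (Real.cosh x + 1) := by
        rw [w_sq, Real.sinh_sq]
        nlinarith [Real.cos_le_one θ]
      have b1 : Real.sinh x / w θ x ^ 3 ≤ Real.sinh x * (Real.cosh x + 1) / w θ x ^ 5 := by
        rw [div_le_div_iff₀ (by positivity) (by positivity)]
        nlinarith [mul_le_mul_of_nonneg_left hW (by positivity : 0 ≤ Real.sinh x * w θ x ^ 3)]
      have b2 : Real.sinh x * Real.cosh x / w θ x ^ 5
          ≤ Real.sinh x * (Real.cosh x + 1) / w θ x ^ 5 := by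
        gcongr
        linarith
      have b3 : Real.sinh x ^ 3 / w θ x ^ 7 ≤ Real.sinh x * (Real.cosh x + 1) / w θ x ^ 5 := by
        rw [div_le_div_iff₀ (by positivity) (by positivity)]
        nlinarith [mul_le_mul_of_nonneg_left hS2 (by positivity : 0 ≤ Real.sinh x * w θ x ^ 5)]
      have n1 : 0 ≤ Real.sinh x / w θ x ^ 3 := by positivity
      have n2 : 0 ≤ Real.sinh x * Real.cosh x / w θ x ^ 5 := by positivity
      have n3 : 0 ≤ Real.sinh x ^ 3 / w θ x ^ 7 := by positivity
      rw [abs_le]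
      constructor <;> linarith)
    (fun x hx => div_nonneg (Real.sinh_nonneg_iff.2 (hu.trans hx)) (pow_nonneg (w_nonneg θ x) 3))
    (fun x => div_nonpos_of_nonpos_of_nonneg (by norm_num) (w_nonneg θ x))
    (fun x => by
      have h1 : -2 / w θ x ≤ 0 := div_nonpos_of_nonpos_of_nonneg (by norm_num) (w_nonneg θ x)
      have h2 : -(2 / 3 * (1 + Real.cos θ)) / w θ x ^ 3 ≤ 0 :=
        div_nonpos_of_nonpos_of_nonneg (by linarith) (pow_nonneg (w_nonneg θ x) 3)
      linarith)
    ((tendsto_w_atTop θ).const_div_atTop (-2))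
  refine main.trans ?_
  have : 2 / 3 * (1 + Real.cos θ) / w θ u ^ 3 ≤ 4 / 3 / w θ u ^ 3 := by
    gcongr
    linarith [Real.cos_le_one θ]
  gcongr
  rw [neg_div, neg_div]
  linarith

theorem g1_eq (r₁ r₂ ε ξ θ s : ℝ) :
    g1 r₁ r₂ ε ξ θ s = w θ ξ ^ 3 / (2 * aEps r₁ r₂ ε) * (Real.sinh (s - ξ) / w θ (s - ξ) ^ 3) := by
  have hw : w θ (ξ - s) = w θ (s - ξ) := by rw [w, w, ← neg_sub s ξ, Real.cosh_neg]
  rw [g1, hw, ← neg_sub s ξ, Real.sinh_neg, div_pow]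
  ring

theorem xi_le {r r₁ r₂ ε : ℝ} (h : 0 ≤ aEps r₁ r₂ ε / r) : xi r r₁ r₂ ε ≤ aEps r₁ r₂ ε / r := by
  have := Real.self_le_sinh_iff.2 (Real.arsinh_nonneg_iff.2 h)
  rwa [Real.sinh_arsinh] at this

theorem aEps_pos {r₁ r₂ ε : ℝ} (hr₁ : 0 < r₁) (hr₂ : 0 < r₂) (hε : 0 < ε) :
    0 < aEps r₁ r₂ ε := by
  unfold aEps
  positivity

theorem aEps_le {r₁ r₂ ε : ℝ} (hr₁ : 0 < r₁) (hr₂ : 0 < r₂) (hε : 0 < ε) (hε1 : ε ≤ 1) :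
    aEps r₁ r₂ ε ≤ Real.sqrt ((2*r₁+1)*(2*r₂+1)*(2*r₁+2*r₂+1)) / (2*(r₁+r₂)) := by
  unfold aEps
  gcongr ?_ / (2 * ?_)
  · rw [← one_mul (Real.sqrt ((2*r₁+1)*(2*r₂+1)*(2*r₁+2*r₂+1)))]
    gcongr
    exact Real.sqrt_le_one.2 hε1
  · exact le_add_of_nonneg_right hε.le

theorem stmt18 (r₁ r₂ : ℝ) (hr₁ : 0 < r₁) (hr₂ : 0 < r₂) :
    ∃ C > 0, ∃ ε₀ > 0, ∀ ε ∈ Set.Ioo 0 ε₀, ∀ c : ℝ,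
      (∀ ξ ∈ Set.Icc (-(xi r₁ r₁ r₂ ε)) (xi r₂ r₁ r₂ ε),
        |ξ| ≤ c - ξ ∧ c - ξ ≤ 3 * (xi r₁ r₁ r₂ ε + xi r₂ r₁ r₂ ε)) →
      ∀ ξ ∈ Set.Icc (-(xi r₁ r₁ r₂ ε)) (xi r₂ r₁ r₂ ε), ∀ θ ∈ Set.Icc 0 Real.pi,
        |(∑' m : ℕ, g1 r₁ r₂ ε ξ θ (2 * sZero r₁ r₂ ε * m + c)) -
          (1 / (2 * sZero r₁ r₂ ε)) *
            ∫ t in Set.Ioi (0:ℝ), g1 r₁ r₂ ε ξ θ (t + c)| ≤ C := by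
  set M := Real.sqrt ((2*r₁+1)*(2*r₂+1)*(2*r₁+2*r₂+1)) / (2*(r₁+r₂)) with hM
  set L := 1 / r₁ + 1 / r₂ with hL
  set Q := Real.cosh (3 * (L * M)) with hQ
  have hL0 : 0 < L := by positivity
  have hQ0 : 0 < Q := Real.cosh_pos _
  refine ⟨3 / 4 * (L * Q) + 5 * L * (2 * (Q + 1) + 4 / 3), by positivity, 1, one_pos, ?_⟩
  rintro ε ⟨hε, hε1⟩ c hc ξ hξ θ -
  obtain ⟨hcl, hcu⟩ := hc ξ hξ
  have ha := aEps_pos hr₁ hr₂ hε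
  have haM : aEps r₁ r₂ ε ≤ M := aEps_le hr₁ hr₂ hε hε1.le
  have hs_pos : 0 < sZero r₁ r₂ ε :=
    add_pos (Real.arsinh_pos_iff.2 (by positivity)) (Real.arsinh_pos_iff.2 (by positivity))
  have hs_le : sZero r₁ r₂ ε ≤ L * aEps r₁ r₂ ε := by
    have h1 := xi_le (r := r₁) (div_pos ha hr₁).le
    have h2 := xi_le (r := r₂) (div_pos ha hr₂).le
    calc sZero r₁ r₂ ε ≤ aEps r₁ r₂ ε / r₁ + aEps r₁ r₂ ε / r₂ := add_le_add h1 h2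
      _ = L * aEps r₁ r₂ ε := by rw [hL]; ring
  change c - ξ ≤ 3 * sZero r₁ r₂ ε at hcu
  simp only [g1_eq]
  set a := aEps r₁ r₂ ε
  set s := sZero r₁ r₂ ε
  set u := c - ξ with hu
  have hu0 : 0 ≤ u := (abs_nonneg ξ).trans hcl
  have harg₁ : ∀ m : ℕ, 2 * s * m + c - ξ = u + 2 * s * m := fun m => by rw [hu]; ring
  have harg₂ : ∀ t : ℝ, t + c - ξ = u + t := fun t => by rw [hu]; ring
  simp only [harg₁, harg₂]
  rw [tsum_mul_left, integral_const_mul, mul_left_comm (1 / (2 * s)), ← mul_sub, abs_mul,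
    abs_of_nonneg (by have := w_nonneg θ ξ; positivity)]
  rcases (w_nonneg θ ξ).eq_or_lt with hw0 | hw0
  · rw [← hw0]
    simp only [ne_eq, OfNat.ofNat_ne_zero, not_false_eq_true, zero_pow, zero_div, zero_mul]
    positivity
  have hww : w θ ξ ≤ w θ u := w_le_w (by rwa [abs_of_nonneg hu0])
  have hwu := hw0.trans_le hww
  have hLM : L * a ≤ L * M := by gcongr
  have huQ : u ≤ 3 * (L * M) := by linarith
  have hS : Real.sinh u ≤ 3 * (L * a) * Q :=
    (sinh_le_self_mul_cosh hu0 huQ).trans (by gcongr; linarith)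
  have hS0 : 0 ≤ Real.sinh u := Real.sinh_nonneg_iff.2 hu0
  have hwQ : w θ ξ ^ 2 ≤ Q + 1 := by
    have : Real.cosh ξ ≤ Q := by
      rw [hQ, Real.cosh_le_cosh, abs_of_nonneg (hu0.trans huQ)]
      exact hcl.trans huQ
    rw [w_sq]
    linarith [Real.neg_one_le_cos θ]
  have hr1 : w θ ξ ^ 3 / w θ u ^ 3 ≤ 1 :=
    div_le_one_of_le₀ (by gcongr) (by positivity)
  have hr2 : w θ ξ ^ 3 / w θ u ≤ Q + 1 := by
    rw [div_le_iff₀ hwu]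
    calc w θ ξ ^ 3 = w θ ξ ^ 2 * w θ ξ := by ring
      _ ≤ (Q + 1) * w θ u := by gcongr
  calc _ ≤ w θ ξ ^ 3 / (2 * a) * (Real.sinh u / w θ u ^ 3 / 2
        + 2 * s / 2 * (10 * (2 / w θ u + 4 / 3 / w θ u ^ 3))) := by
        gcongr
        exact abs_tsum_sinh_div_w_sub_integral_le (by positivity) hu0 hwu
    _ = 1 / (2 * a) * (Real.sinh u * (w θ ξ ^ 3 / w θ u ^ 3) / 2
        + s * (10 * (2 * (w θ ξ ^ 3 / w θ u) + 4 / 3 * (w θ ξ ^ 3 / w θ u ^ 3)))) := by ring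
    _ ≤ 1 / (2 * a) * (3 * (L * a) * Q * 1 / 2
        + L * a * (10 * (2 * (Q + 1) + 4 / 3 * 1))) := by gcongr
    _ = _ := by field_simp; ring

end
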